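/- arXiv:2209.03478 — 2 statements merged into one kernel-verified Lean document; each statement's English description precedes it below -/
import Mathlib

section
/- For every choice of bit strings Q₁=(q₁,q₂,q₃), Q₂=(q₅,q₆,q₇) ∈ {0,1}³, every sign s ∈ {+1,−1}, and all bits a,b,c ∈ {0,1} with a+b+c odd, the 7-qubit vector v_{y,s} satisfies the eigenvalue equation (I ⊗ I ⊗ I ⊗ Y ⊗ P_a ⊗ P_b ⊗ P_c) v_{y,s} = s · (√−1)^{a+b+c+1} · (−1)^{a q₅ + b q₆ + c q₇} · v_{y,s}. -/
open Matrix Complex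

noncomputable section

/-- Single-qubit Pauli X. -/
def Xg : Matrix (Fin 2) (Fin 2) ℂ := !![0, 1; 1, 0]
/-- Single-qubit Pauli Y. -/
def Yg : Matrix (Fin 2) (Fin 2) ℂ := !![0, -Complex.I; Complex.I, 0]
/-- Single-qubit Pauli Z. -/
def Zg : Matrix (Fin 2) (Fin 2) ℂ := !![1, 0; 0, -1]
/-- P₀ = X, P₁ = Y. -/
def Pg : Fin 2 → Matrix (Fin 2) (Fin 2) ℂ := fun i => if i = 0 then Xg else Yg

/-- Tensor (Kronecker) product of `n` single-qubit operators, as a matrix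
indexed by bit strings. -/
def tens {n : ℕ} (M : Fin n → Matrix (Fin 2) (Fin 2) ℂ) :
    Matrix (Fin n → Fin 2) (Fin n → Fin 2) ℂ :=
  Matrix.of fun r c => ∏ m, M m (r m) (c m)

/-- Computational basis vector |q⟩. -/
def ket {n : ℕ} (q : Fin n → Fin 2) : (Fin n → Fin 2) → ℂ :=
  fun r => if r = q then 1 else 0

/-- The eigenvector v_{y,s} of the paper (7 qubits). -/
def vy (q₁ q₂ q₃ q₅ q₆ q₇ : Fin 2) (s : ℂ) : (Fin 7 → Fin 2) → ℂ :=
  (- ket ![q₁, q₂, q₃, 0, q₅, q₆, q₇] + ket ![q₁+1, q₂+1, q₃+1, 0, q₅, q₆, q₇]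
    + ket ![q₁, q₂, q₃, 0, q₅+1, q₆+1, q₇+1]
    + ket ![q₁+1, q₂+1, q₃+1, 0, q₅+1, q₆+1, q₇+1])
  + s • (- ket ![q₁+1, q₂+1, q₃+1, 1, q₅, q₆, q₇] - ket ![q₁, q₂, q₃, 1, q₅, q₆, q₇]
    + ket ![q₁+1, q₂+1, q₃+1, 1, q₅+1, q₆+1, q₇+1]
    - ket ![q₁, q₂, q₃, 1, q₅+1, q₆+1, q₇+1])

theorem tens_mulVec_ket {n : ℕ} {M : Fin n → Matrix (Fin 2) (Fin 2) ℂ} {α : Fin n → ℂ}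
    {p q : Fin n → Fin 2} (h : ∀ m x, M m x (q m) = if x = p m then α m else 0) :
    (tens M).mulVec (ket q) = (∏ m, α m) • ket p := by
  ext r
  have hcol : (tens M).mulVec (ket q) r = ∏ m, M m (r m) (q m) := by
    simp [Matrix.mulVec, dotProduct, tens, ket]
  rw [hcol, Finset.prod_congr rfl fun m _ => h m (r m)]
  by_cases hr : r = p
  · simp [hr, ket]
  · obtain ⟨m, hm⟩ := Function.ne_iff.mp hr
    rw [Finset.prod_eq_zero (Finset.mem_univ m) (if_neg hm)]
    simp [hr, ket]

theorem one_apply_eq_ite (q x : Fin 2) :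
    (1 : Matrix (Fin 2) (Fin 2) ℂ) x q = if x = q then 1 else 0 :=
  Matrix.one_apply

theorem Pg_apply (a q x : Fin 2) :
    Pg a x q = if x = q + 1 then Complex.I ^ (a : ℕ) * (-1) ^ ((a : ℕ) * (q : ℕ)) else 0 := by
  fin_cases a <;> fin_cases q <;> fin_cases x <;> simp [Pg, Xg, Yg]

theorem Yg_apply (q x : Fin 2) :
    Yg x q = if x = q + 1 then Complex.I * (-1) ^ (q : ℕ) else 0 := by
  simpa [Pg] using Pg_apply 1 q x

theorem neg_one_pow_mul_flip (a q : Fin 2) :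
    (-1 : ℂ) ^ ((a : ℕ) * ((q + 1 : Fin 2) : ℕ)) =
      (-1) ^ (a : ℕ) * (-1) ^ ((a : ℕ) * (q : ℕ)) := by
  fin_cases a <;> fin_cases q <;> simp

theorem pauli_mulVec_ket (a b c q₁ q₂ q₃ t q₅ q₆ q₇ : Fin 2) :
    (tens ![1, 1, 1, Yg, Pg a, Pg b, Pg c]).mulVec (ket ![q₁, q₂, q₃, t, q₅, q₆, q₇]) =
      (Complex.I ^ ((a : ℕ) + (b : ℕ) + (c : ℕ) + 1) * (-1) ^ (t : ℕ) *
        ((-1) ^ ((a : ℕ) * (q₅ : ℕ)) * (-1) ^ ((b : ℕ) * (q₆ : ℕ)) *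
          (-1) ^ ((c : ℕ) * (q₇ : ℕ)))) •
        ket ![q₁, q₂, q₃, t + 1, q₅ + 1, q₆ + 1, q₇ + 1] := by
  rw [tens_mulVec_ket (p := ![q₁, q₂, q₃, t + 1, q₅ + 1, q₆ + 1, q₇ + 1])
    (α := ![1, 1, 1, Complex.I * (-1) ^ (t : ℕ),
      Complex.I ^ (a : ℕ) * (-1) ^ ((a : ℕ) * (q₅ : ℕ)),
      Complex.I ^ (b : ℕ) * (-1) ^ ((b : ℕ) * (q₆ : ℕ)),
      Complex.I ^ (c : ℕ) * (-1) ^ ((c : ℕ) * (q₇ : ℕ))])]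
  · congr 1
    simp only [Fin.prod_univ_succ, Matrix.cons_val_zero, Matrix.cons_val_succ,
      Finset.univ_eq_empty, Finset.prod_empty]
    ring
  · intro m x
    fin_cases m
    · exact one_apply_eq_ite q₁ x
    · exact one_apply_eq_ite q₂ x
    · exact one_apply_eq_ite q₃ x
    · exact Yg_apply t x
    · exact Pg_apply a q₅ x
    · exact Pg_apply b q₆ x
    · exact Pg_apply c q₇ x

theorem stmt1 (q₁ q₂ q₃ q₅ q₆ q₇ : Fin 2) (s : ℂ) (hs : s = 1 ∨ s = -1)
    (a b c : Fin 2) (hodd : Odd ((a : ℕ) + (b : ℕ) + (c : ℕ))) :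
    (tens ![1, 1, 1, Yg, Pg a, Pg b, Pg c]).mulVec (vy q₁ q₂ q₃ q₅ q₆ q₇ s) =
      (s * Complex.I ^ ((a : ℕ) + (b : ℕ) + (c : ℕ) + 1) *
        (-1 : ℂ) ^ ((a : ℕ) * (q₅ : ℕ) + (b : ℕ) * (q₆ : ℕ) + (c : ℕ) * (q₇ : ℕ))) •
        vy q₁ q₂ q₃ q₅ q₆ q₇ s := by
  have hsign : (-1 : ℂ) ^ (a : ℕ) * (-1) ^ (b : ℕ) * (-1) ^ (c : ℕ) = -1 := by
    rw [← pow_add, ← pow_add, hodd.neg_one_pow]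
  have hflip : (-1 : ℂ) ^ ((a : ℕ) * ((q₅ + 1 : Fin 2) : ℕ)) *
      (-1) ^ ((b : ℕ) * ((q₆ + 1 : Fin 2) : ℕ)) * (-1) ^ ((c : ℕ) * ((q₇ + 1 : Fin 2) : ℕ)) =
      -((-1) ^ ((a : ℕ) * (q₅ : ℕ)) * (-1) ^ ((b : ℕ) * (q₆ : ℕ)) *
        (-1) ^ ((c : ℕ) * (q₇ : ℕ))) := by
    simp only [neg_one_pow_mul_flip]
    linear_combination ((-1 : ℂ) ^ ((a : ℕ) * (q₅ : ℕ)) * (-1) ^ ((b : ℕ) * (q₆ : ℕ)) *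
      (-1) ^ ((c : ℕ) * (q₇ : ℕ))) * hsign
  have hinv (x : Fin 2) : x + 1 + 1 = x := by fin_cases x <;> rfl
  have hss : s * s = 1 := by rcases hs with rfl | rfl <;> norm_num
  simp only [vy, Matrix.mulVec_add, Matrix.mulVec_sub, Matrix.mulVec_neg, Matrix.mulVec_smul,
    pauli_mulVec_ket, hflip, hinv, pow_add (-1 : ℂ)]
  generalize (-1 : ℂ) ^ ((a : ℕ) * (q₅ : ℕ)) * (-1) ^ ((b : ℕ) * (q₆ : ℕ)) *
    (-1) ^ ((c : ℕ) * (q₇ : ℕ)) = ε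
  generalize Complex.I ^ ((a : ℕ) + (b : ℕ) + (c : ℕ) + 1) = ι
  simp only [Fin.val_zero, Fin.val_one, pow_zero, pow_one, zero_add,
    show (1 + 1 : Fin 2) = 0 from rfl]
  ext r
  simp only [Pi.add_apply, Pi.sub_apply, Pi.neg_apply, Pi.smul_apply, smul_eq_mul]
  generalize ket ![q₁, q₂, q₃, 0, q₅, q₆, q₇] r = A₀
  generalize ket ![q₁+1, q₂+1, q₃+1, 0, q₅, q₆, q₇] r = B₀
  generalize ket ![q₁, q₂, q₃, 0, q₅+1, q₆+1, q₇+1] r = C₀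
  generalize ket ![q₁+1, q₂+1, q₃+1, 0, q₅+1, q₆+1, q₇+1] r = D₀
  generalize ket ![q₁, q₂, q₃, 1, q₅, q₆, q₇] r = A₁
  generalize ket ![q₁+1, q₂+1, q₃+1, 1, q₅, q₆, q₇] r = B₁
  generalize ket ![q₁, q₂, q₃, 1, q₅+1, q₆+1, q₇+1] r = C₁
  generalize ket ![q₁+1, q₂+1, q₃+1, 1, q₅+1, q₆+1, q₇+1] r = D₁
  linear_combination (-ι * ε * (-B₁ - A₁ + D₁ - C₁)) * hss
end
end

section
/- For all bits a,b,c ∈ {0,1} with a+b+c odd, the 7-qubit unitary W_{1y} satisfies the conjugation identity (√−1)^{a+b+c+1} · W_{1y} (I ⊗ I ⊗ I ⊗ Z ⊗ Z^a ⊗ Z^b ⊗ Z^c) W_{1y}† = I ⊗ I ⊗ I ⊗ Y ⊗ P_a ⊗ P_b ⊗ P_c. -/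
open Matrix Complex

noncomputable section

/-- Single-qubit Hadamard gate. -/
def Hg : Matrix (Fin 2) (Fin 2) ℂ := (Real.sqrt 2)⁻¹ • !![1, 1; 1, -1]

/-- CNOT with control `c` and target `t`, acting on `n` qubits. -/
def CNOTg {n : ℕ} (c t : Fin n) : Matrix (Fin n → Fin 2) (Fin n → Fin 2) ℂ :=
  Matrix.of fun r col => if r = Function.update col t (col t + col c) then 1 else 0

/-- C_I = CNOT_{(4,1)} CNOT_{(4,2)} CNOT_{(4,3)} (qubits 1-indexed in the paper). -/
def CI : Matrix (Fin 7 → Fin 2) (Fin 7 → Fin 2) ℂ := CNOTg 3 0 * CNOTg 3 1 * CNOTg 3 2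
/-- C_{II} = CNOT_{(4,5)} CNOT_{(4,6)} CNOT_{(4,7)}. -/
def CII : Matrix (Fin 7 → Fin 2) (Fin 7 → Fin 2) ℂ := CNOTg 3 4 * CNOTg 3 5 * CNOTg 3 6
/-- W_{1y} = C_I · H_{(4)} · Z_{(4)} · C_I · C_{II} · H_{(4)} · C_I. -/
def W1y : Matrix (Fin 7 → Fin 2) (Fin 7 → Fin 2) ℂ :=
  CI * tens ![1, 1, 1, Hg, 1, 1, 1] * tens ![1, 1, 1, Zg, 1, 1, 1] * CI * CII *
    tens ![1, 1, 1, Hg, 1, 1, 1] * CI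

theorem tens_mul {n : ℕ} (M N : Fin n → Matrix (Fin 2) (Fin 2) ℂ) :
    tens M * tens N = tens fun k => M k * N k := by
  ext r s
  simp only [tens, Matrix.mul_apply, Matrix.of_apply, ← Finset.prod_mul_distrib]
  exact (Fintype.prod_sum fun k j => M k (r k) j * N k j (s k)).symm

theorem tens_one {n : ℕ} : tens (fun _ : Fin n => 1) = 1 := by
  ext r s
  simp [tens, Matrix.one_apply, Finset.prod_ite_zero, funext_iff]

theorem tens_conjTranspose {n : ℕ} (M : Fin n → Matrix (Fin 2) (Fin 2) ℂ) :
    (tens M)ᴴ = tens fun k => (M k)ᴴ := by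
  ext r s
  simp [tens]

theorem tens_smul {n : ℕ} (z : Fin n → ℂ) (M : Fin n → Matrix (Fin 2) (Fin 2) ℂ) :
    (tens fun k => z k • M k) = (∏ k, z k) • tens M := by
  ext r s
  simp [tens, Finset.prod_mul_distrib]

theorem tens_mem_unitaryGroup {n : ℕ} {M : Fin n → Matrix (Fin 2) (Fin 2) ℂ}
    (h : ∀ k, M k ∈ unitaryGroup (Fin 2) ℂ) : tens M ∈ unitaryGroup (Fin n → Fin 2) ℂ := by
  rw [mem_unitaryGroup_iff, star_eq_conjTranspose, tens_conjTranspose, tens_mul, ← tens_one]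
  congr 1
  funext k
  exact mem_unitaryGroup_iff.1 (h k)

theorem semiconjBy_tens {n : ℕ} {U M N : Fin n → Matrix (Fin 2) (Fin 2) ℂ}
    (h : ∀ k, SemiconjBy (U k) (M k) (N k)) : SemiconjBy (tens U) (tens M) (tens N) := by
  rw [SemiconjBy, tens_mul, tens_mul]
  congr 1
  funext k
  exact h k

/-- The action of CNOT on bit strings. -/
def cnotFlip {n : ℕ} (c t : Fin n) (q : Fin n → Fin 2) : Fin n → Fin 2 :=
  Function.update q t (q t + q c)

theorem cnotFlip_involutive {n : ℕ} {c t : Fin n} (hct : c ≠ t) :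
    Function.Involutive (cnotFlip c t) := by
  intro q
  have h : ∀ x y : Fin 2, x + y + y = x := by decide
  simp [cnotFlip, hct, h]

theorem CNOTg_apply {n : ℕ} (c t : Fin n) (r s : Fin n → Fin 2) :
    CNOTg c t r s = if r = cnotFlip c t s then 1 else 0 := rfl

theorem CNOTg_mul_apply {n : ℕ} {c t : Fin n} (hct : c ≠ t)
    (A : Matrix (Fin n → Fin 2) (Fin n → Fin 2) ℂ) (r s : Fin n → Fin 2) :
    (CNOTg c t * A) r s = A (cnotFlip c t r) s := by
  simp [Matrix.mul_apply, CNOTg_apply, ← (cnotFlip_involutive hct).eq_iff]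

theorem mul_CNOTg_apply {n : ℕ} (c t : Fin n)
    (A : Matrix (Fin n → Fin 2) (Fin n → Fin 2) ℂ) (r s : Fin n → Fin 2) :
    (A * CNOTg c t) r s = A r (cnotFlip c t s) := by
  simp [Matrix.mul_apply, CNOTg_apply]

theorem CNOTg_mem_unitaryGroup {n : ℕ} {c t : Fin n} (hct : c ≠ t) :
    CNOTg c t ∈ unitaryGroup (Fin n → Fin 2) ℂ := by
  rw [mem_unitaryGroup_iff, star_eq_conjTranspose]
  ext r s
  rw [CNOTg_mul_apply hct, conjTranspose_apply, CNOTg_apply,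
    cnotFlip_involutive hct r]
  simp [Matrix.one_apply, eq_comm]

/-- Conjugation by CNOT maps `A ⊗ B` to `A' ⊗ B'`, the first factor being the control. -/
def CNOTMaps (A B A' B' : Matrix (Fin 2) (Fin 2) ℂ) : Prop :=
  ∀ i i' j j', A i i' * B (j + i) (j' + i') = A' i i' * B' j j'

theorem semiconjBy_CNOTg {n : ℕ} {c t : Fin n} (hct : c ≠ t)
    {M N : Fin n → Matrix (Fin 2) (Fin 2) ℂ} (h : CNOTMaps (M c) (M t) (N c) (N t))
    (hMN : ∀ k, k ≠ c → k ≠ t → M k = N k) :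
    SemiconjBy (CNOTg c t) (tens M) (tens N) := by
  ext r s
  obtain ⟨s, rfl⟩ := (cnotFlip_involutive hct).surjective s
  rw [CNOTg_mul_apply hct, mul_CNOTg_apply, cnotFlip_involutive hct s]
  have split (f : Fin n → ℂ) :
      ∏ k, f k = (f c * f t) * ∏ k ∈ (Finset.univ.erase c).erase t, f k := by
    rw [mul_assoc, Finset.mul_prod_erase _ _ (by simp [hct.symm]),
      Finset.mul_prod_erase _ _ (Finset.mem_univ c)]
  simp only [tens, Matrix.of_apply]
  rw [split, split]
  congr 1
  · simpa [cnotFlip, hct] using h (r c) (s c) (r t) (s t)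
  · refine Finset.prod_congr rfl fun k hk => ?_
    simp only [Finset.mem_erase, Finset.mem_univ, and_true] at hk
    simp [cnotFlip, hk.1, hMN k hk.2 hk.1]

theorem Zg_pow (k : ℕ) : Zg ^ k = !![1, 0; 0, (-1) ^ k] := by
  induction k with
  | zero => simp [Matrix.one_fin_two]
  | succ k ih => rw [pow_succ, ih, Zg]; simp [pow_succ]

theorem Zg_pow_of_odd {k : ℕ} (hk : Odd k) : Zg ^ k = Zg := by
  rw [Zg_pow, hk.neg_one_pow, Zg]

theorem CNOTMaps.of_diagonal {A : Matrix (Fin 2) (Fin 2) ℂ} (h01 : A 0 1 = 0) (h10 : A 1 0 = 0) :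
    CNOTMaps A 1 A 1 := by
  intro i i' j j'
  fin_cases i <;> fin_cases i' <;> fin_cases j <;> fin_cases j' <;> simp [h01, h10]

theorem CNOTMaps.of_antidiagonal {A : Matrix (Fin 2) (Fin 2) ℂ} (h00 : A 0 0 = 0)
    (h11 : A 1 1 = 0) (k : ℕ) : CNOTMaps A (Zg ^ k) (A * Zg ^ k) (Xg * Zg ^ k) := by
  have h : (-1 : ℂ) ^ k * (-1) ^ k = 1 := by rw [← mul_pow]; simp
  intro i i' j j'
  fin_cases i <;> fin_cases i' <;> fin_cases j <;> fin_cases j' <;>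
    simp [Zg_pow, Xg, Matrix.mul_apply, h00, h11, mul_assoc, h]

theorem CNOTMaps.one_of_antidiagonal {A : Matrix (Fin 2) (Fin 2) ℂ} (h00 : A 0 0 = 0)
    (h11 : A 1 1 = 0) : CNOTMaps A 1 A Xg := by
  simpa using of_antidiagonal h00 h11 0

theorem CNOTMaps.Xg_of_antidiagonal {A : Matrix (Fin 2) (Fin 2) ℂ} (h00 : A 0 0 = 0)
    (h11 : A 1 1 = 0) : CNOTMaps A Xg A 1 := by
  intro i i' j j'
  fin_cases i <;> fin_cases i' <;> fin_cases j <;> fin_cases j' <;> simp [Xg, h00, h11]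

/-- `C_I` acts in the same way on each of the first three qubits. -/
theorem semiconjBy_CI {A B B' : Matrix (Fin 2) (Fin 2) ℂ} (h : CNOTMaps A B A B')
    (D E F : Matrix (Fin 2) (Fin 2) ℂ) :
    SemiconjBy CI (tens ![B, B, B, A, D, E, F]) (tens ![B', B', B', A, D, E, F]) := by
  have h2 : SemiconjBy (CNOTg 3 2) (tens ![B, B, B, A, D, E, F])
      (tens ![B, B, B', A, D, E, F]) :=
    semiconjBy_CNOTg (by decide) h (by intro k; fin_cases k <;> simp)
  have h1 : SemiconjBy (CNOTg 3 1) (tens ![B, B, B', A, D, E, F])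
      (tens ![B, B', B', A, D, E, F]) :=
    semiconjBy_CNOTg (by decide) h (by intro k; fin_cases k <;> simp)
  have h0 : SemiconjBy (CNOTg 3 0) (tens ![B, B', B', A, D, E, F])
      (tens ![B', B', B', A, D, E, F]) :=
    semiconjBy_CNOTg (by decide) h (by intro k; fin_cases k <;> simp)
  exact (h0.mul_left h1).mul_left h2

theorem semiconjBy_CII (a b c : ℕ) :
    SemiconjBy CII (tens ![1, 1, 1, Xg, Zg ^ a, Zg ^ b, Zg ^ c])
      (tens ![1, 1, 1, Xg * Zg ^ (a + b + c), Xg * Zg ^ a, Xg * Zg ^ b, Xg * Zg ^ c]) := by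
  have step (k l : ℕ) :
      CNOTMaps (Xg * Zg ^ k) (Zg ^ l) (Xg * Zg ^ (l + k)) (Xg * Zg ^ l) := by
    rw [add_comm, pow_add, ← mul_assoc]
    exact .of_antidiagonal (by simp [Xg, Zg_pow]) (by simp [Xg, Zg_pow]) l
  have h6 : SemiconjBy (CNOTg 3 6) (tens ![1, 1, 1, Xg, Zg ^ a, Zg ^ b, Zg ^ c])
      (tens ![1, 1, 1, Xg * Zg ^ c, Zg ^ a, Zg ^ b, Xg * Zg ^ c]) :=
    semiconjBy_CNOTg (by decide) (by simpa using step 0 c)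
      (by intro k; fin_cases k <;> simp)
  have h5 : SemiconjBy (CNOTg 3 5)
      (tens ![1, 1, 1, Xg * Zg ^ c, Zg ^ a, Zg ^ b, Xg * Zg ^ c])
      (tens ![1, 1, 1, Xg * Zg ^ (b + c), Zg ^ a, Xg * Zg ^ b, Xg * Zg ^ c]) :=
    semiconjBy_CNOTg (by decide) (step c b) (by intro k; fin_cases k <;> simp)
  have h4 : SemiconjBy (CNOTg 3 4)
      (tens ![1, 1, 1, Xg * Zg ^ (b + c), Zg ^ a, Xg * Zg ^ b, Xg * Zg ^ c])
      (tens ![1, 1, 1, Xg * Zg ^ (a + b + c), Xg * Zg ^ a, Xg * Zg ^ b, Xg * Zg ^ c]) :=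
    semiconjBy_CNOTg (by decide) (by simpa [add_assoc] using step (b + c) a)
      (by intro k; fin_cases k <;> simp)
  exact (h4.mul_left h5).mul_left h6

/-- A gate on the fourth qubit. -/
theorem semiconjBy_tens_fourth {U A A' : Matrix (Fin 2) (Fin 2) ℂ} (h : SemiconjBy U A A')
    (B₁ B₂ B₃ D E F : Matrix (Fin 2) (Fin 2) ℂ) :
    SemiconjBy (tens ![1, 1, 1, U, 1, 1, 1]) (tens ![B₁, B₂, B₃, A, D, E, F])
      (tens ![B₁, B₂, B₃, A', D, E, F]) := by
  refine semiconjBy_tens fun k => ?_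
  fin_cases k <;> first | exact h | exact SemiconjBy.one_left _

theorem Hg_semiconjBy_Zg : SemiconjBy Hg Zg Xg := by
  simp [SemiconjBy, Hg, Zg, Xg]

theorem Hg_semiconjBy_Xg : SemiconjBy Hg Xg Zg := by
  simp [SemiconjBy, Hg, Zg, Xg]

theorem Hg_mem_unitaryGroup : Hg ∈ unitaryGroup (Fin 2) ℂ := by
  have h : ((√2 : ℝ) : ℂ)⁻¹ * ((√2 : ℝ) : ℂ)⁻¹ = 1 / 2 := by
    rw [← mul_inv, ← Complex.ofReal_mul, Real.mul_self_sqrt (by norm_num)]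
    norm_num
  rw [mem_unitaryGroup_iff, star_eq_conjTranspose]
  ext i j
  fin_cases i <;> fin_cases j <;> simp [Hg, Matrix.mul_apply, h] <;> norm_num

theorem Zg_mem_unitaryGroup : Zg ∈ unitaryGroup (Fin 2) ℂ := by
  rw [mem_unitaryGroup_iff, star_eq_conjTranspose]
  ext i j
  fin_cases i <;> fin_cases j <;> simp [Zg, Matrix.mul_apply]

theorem W1y_mem_unitaryGroup : W1y ∈ unitaryGroup (Fin 7 → Fin 2) ℂ := by
  have hI : CI ∈ unitaryGroup (Fin 7 → Fin 2) ℂ :=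
    mul_mem (mul_mem (CNOTg_mem_unitaryGroup (by decide)) (CNOTg_mem_unitaryGroup (by decide)))
      (CNOTg_mem_unitaryGroup (by decide))
  have hII : CII ∈ unitaryGroup (Fin 7 → Fin 2) ℂ :=
    mul_mem (mul_mem (CNOTg_mem_unitaryGroup (by decide)) (CNOTg_mem_unitaryGroup (by decide)))
      (CNOTg_mem_unitaryGroup (by decide))
  have fourth {U : Matrix (Fin 2) (Fin 2) ℂ} (hU : U ∈ unitaryGroup (Fin 2) ℂ) :
      tens ![1, 1, 1, U, 1, 1, 1] ∈ unitaryGroup (Fin 7 → Fin 2) ℂ := by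
    refine tens_mem_unitaryGroup fun k => ?_
    fin_cases k <;> first | exact hU | exact one_mem _
  have hH := fourth Hg_mem_unitaryGroup
  exact mul_mem (mul_mem (mul_mem (mul_mem (mul_mem (mul_mem hI hH)
    (fourth Zg_mem_unitaryGroup)) hI) hII) hH) hI

theorem semiconjBy_W1y {a b c : ℕ} (hodd : Odd (a + b + c)) :
    SemiconjBy W1y (tens ![1, 1, 1, Zg, Zg ^ a, Zg ^ b, Zg ^ c])
      (tens ![1, 1, 1, Xg * Zg, Xg * Zg ^ a, Xg * Zg ^ b, Xg * Zg ^ c]) := by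
  have hII := semiconjBy_CII a b c
  rw [Zg_pow_of_odd hodd] at hII
  have hZ : SemiconjBy Zg (Xg * Zg) (Zg * Xg) := (mul_assoc _ _ _).symm
  have hH : SemiconjBy Hg (Zg * Xg) (Xg * Zg) := Hg_semiconjBy_Zg.mul_right Hg_semiconjBy_Xg
  have hXZ : CNOTMaps (Xg * Zg) 1 (Xg * Zg) Xg :=
    .one_of_antidiagonal (by simp [Xg, Zg]) (by simp [Xg, Zg])
  have hXZ' : CNOTMaps (Xg * Zg) Xg (Xg * Zg) 1 :=
    .Xg_of_antidiagonal (by simp [Xg, Zg]) (by simp [Xg, Zg])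
  exact ((((((semiconjBy_CI hXZ' _ _ _).mul_left
    (semiconjBy_tens_fourth hH _ _ _ _ _ _)).mul_left
    (semiconjBy_tens_fourth hZ _ _ _ _ _ _)).mul_left
    (semiconjBy_CI hXZ _ _ _)).mul_left hII).mul_left
    (semiconjBy_tens_fourth Hg_semiconjBy_Zg _ _ _ _ _ _)).mul_left
    (semiconjBy_CI (.of_diagonal (by simp [Zg]) (by simp [Zg])) _ _ _)

theorem Xg_mul_Zg : Xg * Zg = (-I) • Yg := by
  simp [Xg, Yg, Zg]

theorem Xg_mul_Zg_pow (a : Fin 2) : Xg * Zg ^ (a : ℕ) = (-I) ^ (a : ℕ) • Pg a := by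
  fin_cases a
  · simp [Pg]
  · simp [Pg, Xg_mul_Zg]

theorem stmt4 (a b c : Fin 2) (hodd : Odd ((a : ℕ) + (b : ℕ) + (c : ℕ))) :
    Complex.I ^ ((a : ℕ) + (b : ℕ) + (c : ℕ) + 1) •
      (W1y * tens ![1, 1, 1, Zg, Zg ^ (a : ℕ), Zg ^ (b : ℕ), Zg ^ (c : ℕ)] * W1yᴴ) =
    tens ![1, 1, 1, Yg, Pg a, Pg b, Pg c] := by
  have hW : W1y * W1yᴴ = 1 := mem_unitaryGroup_iff.1 W1y_mem_unitaryGroup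
  have hM : ![1, 1, 1, Xg * Zg, Xg * Zg ^ (a : ℕ), Xg * Zg ^ (b : ℕ), Xg * Zg ^ (c : ℕ)] =
      fun k => ![1, 1, 1, -I, (-I) ^ (a : ℕ), (-I) ^ (b : ℕ), (-I) ^ (c : ℕ)] k •
        ![1, 1, 1, Yg, Pg a, Pg b, Pg c] k := by
    funext k
    fin_cases k <;> simp [Xg_mul_Zg, Xg_mul_Zg_pow]
  have hphase : ∏ k, ![1, 1, 1, -I, (-I) ^ (a : ℕ), (-I) ^ (b : ℕ), (-I) ^ (c : ℕ)] k =
      (-I) ^ ((a : ℕ) + b + c + 1) := by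
    simp only [Fin.prod_univ_seven, pow_add]
    simp
    ring
  rw [(semiconjBy_W1y hodd).eq, mul_assoc, hW, mul_one, hM, tens_smul, hphase, smul_smul,
    ← mul_pow]
  simp
end
end
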